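/- arXiv:1206.0326 — 3 statements merged into one kernel-verified Lean document; each statement's English description precedes it below -/
import Mathlib

section
/- Let R be a finite-dimensional commutative algebra over a perfect field F of characteristic p > 0, graded by the positive integers, generated by its degree-1 component R_1, and satisfying (R_2)^(p) = 0 (every element of R_2 has p-th power zero). Then dim R_i ≥ dim R^(p) for i = 1,...,p, and consequently dim R ≥ p · dim R^(p). -/
open Pointwise

/-- `pw x n` is the `n`-th power of `x` in any magma, for `n ≥ 1`
(with the junk value `pw x 0 = x`). -/
def pw {R : Type*} [Mul R] (x : R) : ℕ → R
  | 0 => x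
  | 1 => x
  | n + 2 => x * pw x (n + 1)

/-- Product of submodules of a (possibly nonunital) algebra: the span of the
set of products. -/
noncomputable instance submul {F R : Type*} [Semiring F] [NonUnitalNonAssocSemiring R]
    [Module F R] : Mul (Submodule F R) :=
  ⟨fun V W => Submodule.span F (Set.image2 (· * ·) (V : Set R) (W : Set R))⟩

open scoped TensorProduct

section Height

variable {F ι : Type*} [Field F] [Finite ι]

/-- The ideal of variables has height at least the number of variables. -/
theorem MvPolynomial.card_le_height_ker_constantCoeff :
    (Nat.card ι : ℕ∞) ≤ (RingHom.ker (constantCoeff : MvPolynomial ι F →+* F)).height := by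
  classical
  cases nonempty_fintype ι
  let φ (s : Finset ι) : MvPolynomial ι F →ₐ[F] MvPolynomial ι F :=
    aeval fun j => if j ∈ s then 0 else X j
  have hφX (s : Finset ι) (j : ι) : φ s (X j) = if j ∈ s then 0 else X j := aeval_X _ _
  have key (s : Finset ι) : (s.card : ℕ∞) ≤ (RingHom.ker (φ s)).height := by
    induction s using Finset.induction_on with
    | empty => simp
    | insert a s ha ih =>
      rw [Finset.card_insert_of_notMem ha, Nat.cast_add, Nat.cast_one]
      have := RingHom.ker_isPrime (φ s)
      have := RingHom.ker_isPrime (φ (insert a s))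
      refine (add_le_add_left ih 1).trans (Ideal.height_add_one_le_of_lt_of_isPrime ?_)
      have hcomp : φ (insert a s) = (φ {a}).comp (φ s) := by
        refine algHom_ext fun j => ?_
        rw [AlgHom.comp_apply, hφX, hφX]
        by_cases hj : j ∈ s <;> simp [hj, hφX]
      refine SetLike.lt_iff_le_and_exists.2 ⟨fun f hf => ?_, X a, ?_, ?_⟩
      · rw [RingHom.mem_ker] at hf ⊢
        rw [hcomp, AlgHom.comp_apply, hf, map_zero]
      · simp [RingHom.mem_ker, hφX]
      · simp [RingHom.mem_ker, hφX, ha]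
  have huniv : RingHom.ker (φ Finset.univ) =
      RingHom.ker (constantCoeff : MvPolynomial ι F →+* F) := by
    ext f
    have : φ Finset.univ f = C (constantCoeff f) := by
      simp only [φ, Finset.mem_univ, if_true, aeval_zero', algebraMap_eq]
    simp [RingHom.mem_ker, this]
  have := key Finset.univ
  rwa [huniv, Finset.card_univ, ← Nat.card_eq_fintype_card] at this

/-- If an ideal generated by `m` polynomials without constant term contains a power of every
variable, then there are at most `m` variables. -/
theorem MvPolynomial.card_le_of_X_pow_mem_span {m p : ℕ} (f : Fin m → MvPolynomial ι F)
    (hf : ∀ k, constantCoeff (f k) = 0) (hX : ∀ j, X j ^ p ∈ Ideal.span (Set.range f)) :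
    Nat.card ι ≤ m := by
  have hmin : RingHom.ker (constantCoeff : MvPolynomial ι F →+* F) ∈
      (Ideal.span (Set.range f)).minimalPrimes := by
    refine ⟨⟨RingHom.ker_isPrime _, Ideal.span_le.2 ?_⟩, ?_⟩
    · rintro _ ⟨k, rfl⟩
      exact hf k
    · rintro q ⟨hq, hIq⟩ - g hg
      have hhom : Ideal.Quotient.mkₐ F q =
          (Ideal.Quotient.mkₐ F q).comp (aeval (0 : ι → MvPolynomial ι F)) := by
        refine algHom_ext fun j => ?_
        rw [AlgHom.comp_apply, aeval_X, Pi.zero_apply, map_zero]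
        exact Ideal.Quotient.eq_zero_iff_mem.2 (hq.mem_of_pow_mem p (hIq (hX j)))
      have hg' : aeval (0 : ι → MvPolynomial ι F) g = 0 := by
        rw [RingHom.mem_ker] at hg
        rw [aeval_zero, hg, map_zero]
      have := DFunLike.congr_fun hhom g
      rw [AlgHom.comp_apply, hg', map_zero] at this
      exact Ideal.Quotient.eq_zero_iff_mem.1 this
  have h := card_le_height_ker_constantCoeff.trans
    (Ideal.height_le_card_of_mem_minimalPrimes_span (Set.finite_range f) hmin)
  have hm : (Set.range f).ncard ≤ m := by
    simpa [← Set.image_univ] using Set.ncard_image_le (f := f) Set.finite_univ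
  exact (Nat.cast_le.1 h).trans hm

end Height

/-- If `p`-th powers of a family of `d` elements of degree one are linearly independent, then every
component of degree `1, …, p` has dimension at least `d`. -/
theorem card_le_finrank_of_linearIndependent_pow {F S ι : Type*} [Field F] [CommRing S]
    [Algebra F S] [Finite ι] {p : ℕ} [Fact p.Prime] [CharP F p] (A : ℕ → Submodule F S)
    (hA : ∀ n, ∀ a ∈ A 1, ∀ b ∈ A (n + 1), a * b ∈ A (n + 2)) (y : ι → S) (hy : ∀ j, y j ∈ A 1)
    (hli : LinearIndependent F fun j => y j ^ p) {n : ℕ} (hn : n < p)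
    [FiniteDimensional F (A (n + 1))] :
    Nat.card ι ≤ Module.finrank F (A (n + 1)) := by
  classical
  cases nonempty_fintype ι
  rcases subsingleton_or_nontrivial S with hS | hS
  · have : IsEmpty ι := ⟨fun j => hli.ne_zero j (Subsingleton.elim _ _)⟩
    simp
  let T := MvPolynomial ι F
  let N : Ideal T := RingHom.ker (MvPolynomial.constantCoeff : T →+* F)
  let x : T ⊗[F] S := ∑ j, MvPolynomial.X j ⊗ₜ[F] y j
  have hXN (j : ι) : (MvPolynomial.X j : T) ∈ N := by simp [N, RingHom.mem_ker]
  have hX (j : ι) (s : S) : (MvPolynomial.X j : T) ⊗ₜ[F] s =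
      (MvPolynomial.X j : T) • ((1 : T) ⊗ₜ[F] s) := by
    rw [TensorProduct.smul_tmul', smul_eq_mul, mul_one]
  have hx (n : ℕ) : x ^ (n + 1) ∈ N • (A (n + 1)).baseChange T := by
    induction n with
    | zero =>
      rw [zero_add, pow_one]
      refine Submodule.sum_mem _ fun j _ => ?_
      rw [hX]
      exact Submodule.smul_mem_smul (hXN j) (Submodule.tmul_mem_baseChange_of_mem _ (hy j))
    | succ n ih =>
      rw [pow_succ' x (n + 1), Finset.sum_mul]
      refine Submodule.sum_mem _ fun j _ => ?_
      rw [hX, smul_mul_assoc]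
      refine Submodule.smul_mem_smul (hXN j) ?_
      have hle : (A (n + 1)).baseChange T ≤ ((A (n + 2)).baseChange T).comap
          (LinearMap.mulLeft T ((1 : T) ⊗ₜ[F] y j)) := by
        rw [Submodule.baseChange_eq_span, Submodule.span_le]
        rintro _ ⟨b, hb, rfl⟩
        simpa using Submodule.tmul_mem_baseChange_of_mem (1 : T) (hA n _ (hy j) b hb)
      exact hle (Submodule.smul_le_right ih)
  let b := Module.finBasis F (A (n + 1))
  have hspan : (A (n + 1)).baseChange T =
      Submodule.span T (Set.range fun k => (1 : T) ⊗ₜ[F] (b k : S)) := by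
    have h1 : A (n + 1) = Submodule.span F (Set.range fun k => (b k : S)) := by
      have := congrArg (Submodule.map (A (n + 1)).subtype) b.span_eq
      rw [Submodule.map_span, ← Set.range_comp, Submodule.map_subtype_top] at this
      exact this.symm
    conv_lhs => rw [h1]
    rw [Submodule.baseChange_span, ← Set.range_comp]
    rfl
  have hxn := hx n
  rw [hspan, Submodule.mem_ideal_smul_span_iff_exists_sum] at hxn
  obtain ⟨c, hc, hsum⟩ := hxn
  rw [Finsupp.sum_fintype _ _ (by simp)] at hsum
  refine MvPolynomial.card_le_of_X_pow_mem_span (p := p) c hc fun j => ?_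
  obtain ⟨φ, hφ⟩ : ∃ φ : S →ₗ[F] F, ∀ k, φ (y k ^ p) = if k = j then 1 else 0 := by
    obtain ⟨g, hg⟩ := LinearMap.exists_leftInverse_of_injective _ (linearIndependent_iff_ker.1 hli)
    refine ⟨Finsupp.lapply j ∘ₗ g, fun k => ?_⟩
    have := LinearMap.congr_fun hg (Finsupp.single k 1)
    rw [LinearMap.comp_apply, Finsupp.linearCombination_single, one_smul] at this
    simp [this, Finsupp.single_apply]
  let Φ : T ⊗[F] S →ₗ[T] T :=
    (TensorProduct.AlgebraTensorModule.rid F T T).toLinearMap ∘ₗ φ.baseChange T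
  have : CharP (T ⊗[F] S) p := charP_of_injective_algebraMap' F p
  have hΦ : Φ (x ^ p) = MvPolynomial.X j ^ p := by
    have hxp : x ^ p = ∑ k, (MvPolynomial.X k ^ p : T) ⊗ₜ[F] (y k ^ p) := by
      rw [sum_pow_char]
      exact Finset.sum_congr rfl fun k _ => Algebra.TensorProduct.tmul_pow _ _ _
    simp [hxp, Φ, hφ]
  rw [← hΦ, ← Nat.add_sub_cancel' (Nat.succ_le_of_lt hn), pow_add, Nat.succ_eq_add_one, ← hsum,
    Finset.sum_mul, map_sum]
  refine Submodule.sum_mem _ fun k _ => ?_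
  rw [smul_mul_assoc, map_smul, smul_eq_mul]
  exact Ideal.mul_mem_right _ _ (Ideal.subset_span ⟨k, rfl⟩)

theorem iSupIndep.sum_finrank_le {F M ι : Type*} [Field F] [AddCommGroup M] [Module F M]
    [FiniteDimensional F M] {A : ι → Submodule F M} (hA : iSupIndep A) (s : Finset ι) :
    ∑ i ∈ s, Module.finrank F (A i) ≤ Module.finrank F M := by
  classical
  have hs : iSupIndep fun i : s => A i := hA.comp Subtype.val_injective
  have := LinearMap.finrank_le_finrank_of_injective hs.dfinsupp_lsum_injective
  rw [← Finset.sum_coe_sort]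
  exact (Module.finrank_directSum (R := F) fun i : s => A i).symm.trans_le this

section Pw

theorem pw_succ {R : Type*} [Mul R] (x : R) {n : ℕ} (hn : n ≠ 0) : pw x (n + 1) = x * pw x n := by
  obtain ⟨m, rfl⟩ := Nat.exists_eq_succ_of_ne_zero hn
  rfl

theorem pw_zero {R : Type*} [MulZeroClass R] (n : ℕ) : pw (0 : R) n = 0 := by
  rcases n with _ | _ | n
  · rfl
  · rfl
  · exact zero_mul _

theorem pw_mul {R : Type*} [CommSemigroup R] (x y : R) (n : ℕ) :
    pw (x * y) n = pw x n * pw y n := by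
  rcases eq_or_ne n 0 with rfl | hn
  · rfl
  induction n, Nat.one_le_iff_ne_zero.2 hn using Nat.le_induction with
  | base => rfl
  | succ n hn ih =>
    have hn' : n ≠ 0 := by omega
    rw [pw_succ _ hn', pw_succ _ hn', pw_succ _ hn', ih hn', mul_mul_mul_comm]

theorem Unitization.inr_pw (F : Type*) {R : Type*} [Field F] [NonUnitalCommRing R] [Module F R]
    (x : R) {n : ℕ} [SMulCommClass F R R] [IsScalarTower F R R] (hn : n ≠ 0) :
    (inr (pw x n) : Unitization F R) = inr x ^ n := by
  induction n, Nat.one_le_iff_ne_zero.2 hn using Nat.le_induction with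
  | base => simp [pw]
  | succ n hn ih =>
    rw [pw_succ x (by omega), inr_mul, ih (by omega), pow_succ']

variable {F R : Type*} [Field F] [NonUnitalCommRing R] [Module F R] [SMulCommClass F R R]
  [IsScalarTower F R R]

theorem pw_smul (c : F) (x : R) {n : ℕ} (hn : n ≠ 0) : pw (c • x) n = c ^ n • pw x n := by
  apply Unitization.inr_injective (R := F)
  simp only [Unitization.inr_smul, Unitization.inr_pw F _ hn, smul_pow]

theorem pw_add_char (F : Type*) {R : Type*} [Field F] [NonUnitalCommRing R] [Module F R]
    [SMulCommClass F R R] [IsScalarTower F R R] {p : ℕ} [hp : Fact p.Prime] [CharP F p] (x y : R) :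
    pw (x + y) p = pw x p + pw y p := by
  have : CharP (Unitization F R) p := charP_of_injective_algebraMap' F p
  apply Unitization.inr_injective (R := F)
  simp only [Unitization.inr_add, Unitization.inr_pw F _ hp.out.ne_zero, add_pow_char]

variable {p : ℕ} [hp : Fact p.Prime] [CharP F p]

/-- If `p`-th powers of products of two generators vanish, so do those of all products. -/
theorem pw_mul_eq_zero_of_adjoin_eq_top {s : Set R} (hs : NonUnitalAlgebra.adjoin F s = ⊤)
    (h : ∀ x ∈ s, ∀ y ∈ s, pw (x * y) p = 0) (x y : R) : pw (x * y) p = 0 := by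
  have mem (z : R) : z ∈ NonUnitalAlgebra.adjoin F s := hs ▸ NonUnitalAlgebra.mem_top
  have h0 := hp.out.ne_zero
  induction mem x, mem y using NonUnitalAlgebra.adjoin_induction₂ with
  | mem_mem x y hx hy => exact h x hx y hy
  | zero_left => rw [zero_mul, pw_zero]
  | zero_right => rw [mul_zero, pw_zero]
  | add_left x y z _ _ _ hx hy => rw [add_mul, pw_add_char F, hx, hy, add_zero]
  | add_right x y z _ _ _ hx hy => rw [mul_add, pw_add_char F, hx, hy, add_zero]
  | mul_left x y z _ _ _ hx hy => rw [mul_assoc, pw_mul, hy, mul_zero]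
  | mul_right x y z _ _ _ hx hy => rw [← mul_assoc, pw_mul, hx, zero_mul]
  | smul_left r x y _ _ hx => rw [smul_mul_assoc, pw_smul _ _ h0, hx, smul_zero]
  | smul_right r x y _ _ hx => rw [mul_smul_comm, pw_smul _ _ h0, hx, smul_zero]

/-- If `p`-th powers of products of two generators vanish, then the `p`-th powers of the generators
span all `p`-th powers. -/
theorem span_range_pw_eq_of_adjoin_eq_top {s : Set R} (hs : NonUnitalAlgebra.adjoin F s = ⊤)
    (h : ∀ x ∈ s, ∀ y ∈ s, pw (x * y) p = 0) :
    Submodule.span F (Set.range fun x : R => pw x p) =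
      Submodule.span F ((fun x : R => pw x p) '' s) := by
  refine le_antisymm (Submodule.span_le.2 ?_) (Submodule.span_mono (Set.image_subset_range _ _))
  rintro _ ⟨x, rfl⟩
  have mem : x ∈ NonUnitalAlgebra.adjoin F s := hs ▸ NonUnitalAlgebra.mem_top
  induction mem using NonUnitalAlgebra.adjoin_induction with
  | mem x hx => exact Submodule.subset_span ⟨x, hx, rfl⟩
  | zero => simp only [pw_zero, SetLike.mem_coe, zero_mem]
  | add x y _ _ hx hy => simpa only [pw_add_char F, SetLike.mem_coe] using add_mem hx hy
  | mul x y _ _ _ _ =>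
    simp only [pw_mul_eq_zero_of_adjoin_eq_top hs h, SetLike.mem_coe, zero_mem]
  | smul r x _ hx =>
    simpa only [pw_smul _ _ hp.out.ne_zero, SetLike.mem_coe] using Submodule.smul_mem _ _ hx

end Pw

theorem stmt_5 {F R : Type*} [Field F] (p : ℕ) (hp : p.Prime) [CharP F p]
    (hperf : ∀ a : F, ∃ b : F, b ^ p = a)
    [NonUnitalCommRing R] [Module F R] [SMulCommClass F R R] [IsScalarTower F R R]
    [FiniteDimensional F R]
    (A : ℕ → Submodule F R) (hmul : ∀ i j, A i * A j ≤ A (i + j))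
    (hinternal : DirectSum.IsInternal A) (h0 : A 0 = ⊥)
    (hgen : NonUnitalAlgebra.adjoin F ((A 1 : Submodule F R) : Set R) = ⊤)
    (h2 : ∀ x ∈ A 2, pw x p = 0) :
    (∀ i, 1 ≤ i → i ≤ p →
        Module.finrank F (Submodule.span F (Set.range fun x : R => pw x p))
          ≤ Module.finrank F (A i)) ∧
    p * Module.finrank F (Submodule.span F (Set.range fun x : R => pw x p))
      ≤ Module.finrank F R := by
  have := Fact.mk hp
  have hA (i j : ℕ) (a : R) (ha : a ∈ A i) (b : R) (hb : b ∈ A j) : a * b ∈ A (i + j) :=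
    hmul i j (Submodule.subset_span ⟨a, ha, b, hb, rfl⟩)
  have main : ∀ i, 1 ≤ i → i ≤ p →
      Module.finrank F (Submodule.span F (Set.range fun x : R => pw x p))
        ≤ Module.finrank F (A i) := by
    intro i hi hip
    obtain ⟨n, rfl⟩ := Nat.exists_eq_add_of_le' hi
    rw [span_range_pw_eq_of_adjoin_eq_top hgen fun x hx y hy => h2 _ (hA 1 1 x hx y hy)]
    obtain ⟨f, hf, -, hli⟩ :=
      Submodule.exists_fun_fin_finrank_span_eq F ((fun x : R => pw x p) '' (A 1 : Set R))
    choose y hy hyf using hf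
    let inr : R →ₗ[F] Unitization F R := Unitization.inrHom F F R
    have hinr : Function.Injective inr := Unitization.inr_injective
    have := card_le_finrank_of_linearIndependent_pow (F := F) (p := p) (n := n)
      (fun i => (A i).map inr) ?_ (fun j => inr (y j)) (fun j => ⟨y j, hy j, rfl⟩) ?_ hip
    · rwa [Nat.card_fin, ← (Submodule.equivMapOfInjective inr hinr (A (n + 1))).finrank_eq] at this
    · rintro n _ ⟨a, ha, rfl⟩ _ ⟨b, hb, rfl⟩
      refine ⟨a * b, ?_, Unitization.inr_mul F a b⟩
      have := hA 1 (n + 1) a ha b hb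
      rwa [show 1 + (n + 1) = n + 2 by omega] at this
    · have heq : (fun j => inr (y j) ^ p) = inr ∘ f := by
        ext1 j
        rw [Function.comp_apply, ← hyf]
        exact (Unitization.inr_pw F (y j) hp.ne_zero).symm
      rw [heq]
      exact hli.map' inr (LinearMap.ker_eq_bot.2 hinr)
  refine ⟨main, ?_⟩
  calc p * Module.finrank F (Submodule.span F (Set.range fun x : R => pw x p))
      = ∑ _i ∈ Finset.Icc 1 p,
          Module.finrank F (Submodule.span F (Set.range fun x : R => pw x p)) := by simp
    _ ≤ ∑ i ∈ Finset.Icc 1 p, Module.finrank F (A i) :=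
        Finset.sum_le_sum fun i hi => main i (Finset.mem_Icc.1 hi).1 (Finset.mem_Icc.1 hi).2
    _ ≤ Module.finrank F R := hinternal.submodule_iSupIndep.sum_finrank_le _
end

section
/- Let R be a finite-dimensional nilpotent commutative algebra over a perfect field F of characteristic p > 0. Then dim R ≥ p · dim(R^(p)/(R^(p) ∩ R^(p+1))). -/
open Pointwise

section

variable {F : Type*} [Field F]

theorem Submodule.exists_coordinates_mod {A : Type*} [AddCommGroup A] [Module F A]
    [FiniteDimensional F A] {V W : Submodule F A} (hWV : W ≤ V) :
    ∃ (d : ℕ) (φ : Fin d → A →ₗ[F] F) (e : Fin d → A),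
      d + Module.finrank F W = Module.finrank F V ∧
        ∀ y ∈ V, y - ∑ l, φ l y • e l ∈ W := by
  let b := Module.finBasis F (V.map W.mkQ)
  choose φ hφ using fun l => LinearMap.exists_extend (b.coord l)
  choose e he using fun l => W.mkQ_surjective (b l)
  refine ⟨_, fun l => φ l ∘ₗ W.mkQ, e, ?_, fun y hy => ?_⟩
  · have h := LinearMap.finrank_range_add_finrank_ker (W.mkQ.domRestrict V)
    rw [LinearMap.range_domRestrict, LinearMap.ker_domRestrict, Submodule.ker_mkQ] at h
    rw [← h, (Submodule.comapSubtypeEquivOfLe hWV).finrank_eq]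
  · rw [← Submodule.Quotient.mk_eq_zero, ← Submodule.mkQ_apply, map_sub, map_sum, sub_eq_zero]
    have hr := congrArg Subtype.val
      (b.sum_repr ⟨W.mkQ y, Submodule.mem_map_of_mem hy⟩)
    simp only [AddSubmonoidClass.coe_finsetSum, Submodule.coe_smul] at hr
    refine hr.symm.trans (Finset.sum_congr rfl fun l _ => ?_)
    rw [map_smul, he]
    congr 1
    exact (LinearMap.congr_fun (hφ l) ⟨W.mkQ y, Submodule.mem_map_of_mem hy⟩).symm

namespace MvPolynomial

theorem le_height_ker_aeval_zero (F : Type*) [Field F] (k : ℕ) :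
    (k : ℕ∞) ≤ (RingHom.ker (aeval (0 : Fin k → F) : MvPolynomial (Fin k) F →ₐ[F] F)).height := by
  let g : ℕ → MvPolynomial (Fin k) F →ₐ[F] MvPolynomial (Fin k) F := fun j =>
    aeval fun i => if (i : ℕ) < j then 0 else X i
  have hlt : ∀ j < k, RingHom.ker (g j) < RingHom.ker (g (j + 1)) := by
    intro j hj
    have hcomp : (g (j + 1)).comp (g j) = g (j + 1) := by
      ext1 i
      by_cases hi : (i : ℕ) < j
      · simp [g, hi, hi.le]
      · simp [g, hi]
    refine lt_of_le_of_ne (fun x hx => ?_) fun h => ?_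
    · rw [RingHom.mem_ker] at hx ⊢
      rw [← hcomp, AlgHom.comp_apply, hx, map_zero]
    · have hX : X ⟨j, hj⟩ ∈ RingHom.ker (g (j + 1)) := by simp [g]
      rw [← h] at hX
      simp [g] at hX
  have hle : ∀ j ≤ k, (j : ℕ∞) ≤ (RingHom.ker (g j)).height := by
    intro j
    induction j with
    | zero => simp
    | succ j ih =>
      intro hj
      have := RingHom.ker_isPrime (g j)
      have := RingHom.ker_isPrime (g (j + 1))
      push_cast
      exact (add_le_add_left (ih (by omega)) 1).trans
        (Ideal.height_add_one_le_of_lt_of_isPrime (hlt j hj))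
  refine (hle k le_rfl).trans (Ideal.height_mono fun x hx => ?_)
  have hcomp : (aeval (0 : Fin k → F)).comp (g k) = aeval (0 : Fin k → F) := by
    ext1 i
    simp [g]
  rw [RingHom.mem_ker] at hx ⊢
  rw [← hcomp, AlgHom.comp_apply, hx, map_zero]

theorem le_of_X_pow_mem_span {k d : ℕ} (f : Fin d → MvPolynomial (Fin k) F)
    (hf : ∀ l, coeff 0 (f l) = 0) (n : ℕ)
    (hX : ∀ j, X j ^ n ∈ Ideal.span (Set.range f)) : k ≤ d := by
  have hprime := RingHom.ker_isPrime (aeval (0 : Fin k → F) : MvPolynomial (Fin k) F →ₐ[F] F)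
  have hmin : RingHom.ker (aeval (0 : Fin k → F) : MvPolynomial (Fin k) F →ₐ[F] F) ∈
      (Ideal.span (Set.range f)).minimalPrimes := by
    refine ⟨⟨hprime, ?_⟩, fun P hP _ => ?_⟩
    · rw [Ideal.span_le]
      rintro _ ⟨l, rfl⟩
      simpa [constantCoeff_eq] using hf l
    · have hXP : idealOfVars (Fin k) F ≤ P := by
        rw [Ideal.span_le]
        rintro _ ⟨j, rfl⟩
        exact hP.1.mem_of_pow_mem n (hP.2 (hX j))
      refine le_trans (fun x hx => ?_) hXP
      rw [← pow_one (idealOfVars (Fin k) F), mem_pow_idealOfVars_iff']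
      intro s hs
      have hs0 : s = 0 := by simpa [Finsupp.degree_eq_zero_iff] using hs
      rw [RingHom.mem_ker, aeval_zero] at hx
      simpa [hs0, constantCoeff_eq] using hx
  have hle := (le_height_ker_aeval_zero F k).trans
    (Ideal.height_le_card_of_mem_minimalPrimes_span (Set.finite_range f) hmin)
  have hcard : (Set.range f).ncard ≤ d := by
    rw [← Set.image_univ]
    exact (Set.ncard_image_le).trans (by simp [Set.ncard_univ])
  exact (Nat.cast_le.mp hle).trans hcard

variable {σ A : Type*} [CommRing A] [Algebra F A]

/-- Apply a linear functional to every coefficient of a polynomial. -/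
noncomputable def mapFunctional (φ : A →ₗ[F] F) : MvPolynomial σ A →ₗ[F] MvPolynomial σ F :=
  (AddMonoidAlgebra.coeffLinearEquiv F).symm.toLinearMap ∘ₗ
    Finsupp.mapRange.linearMap φ ∘ₗ (AddMonoidAlgebra.coeffLinearEquiv F).toLinearMap

@[simp]
theorem coeff_mapFunctional (φ : A →ₗ[F] F) (s : σ →₀ ℕ) (P : MvPolynomial σ A) :
    coeff s (mapFunctional φ P) = φ (coeff s P) :=
  rfl

theorem mapFunctional_map_mul (φ : A →ₗ[F] F) (f : MvPolynomial σ F) (P : MvPolynomial σ A) :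
    mapFunctional φ (map (algebraMap F A) f * P) = f * mapFunctional φ P := by
  classical
  ext s
  simp only [coeff_mapFunctional, coeff_mul, map_sum, coeff_map, ← Algebra.smul_def, map_smul,
    smul_eq_mul]

theorem mapFunctional_C (φ : A →ₗ[F] F) (a : A) :
    mapFunctional (σ := σ) φ (C a) = C (φ a) := by
  classical
  ext s
  simp only [coeff_mapFunctional, coeff_C]
  split_ifs <;> simp

end MvPolynomial

open MvPolynomial in
theorem Ideal.add_finrank_pow_succ_le {A : Type*} [CommRing A] [Algebra F A]
    [FiniteDimensional F A] (M : Ideal A) {p : ℕ} [ExpChar A p] {k : ℕ} (u : Fin k → A)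
    (hu : ∀ j, u j ∈ M) (ψ : Fin k → A →ₗ[F] F)
    (hψu : ∀ j m, ψ j (u m ^ p) = if j = m then 1 else 0)
    (hψ : ∀ j, ∀ a ∈ M ^ (p + 1), ψ j a = 0) {i : ℕ} (hi : 1 ≤ i) (hip : i ≤ p) :
    k + Module.finrank F ((M ^ (i + 1)).restrictScalars F) ≤
      Module.finrank F ((M ^ i).restrictScalars F) := by
  obtain ⟨d, φ, e, hd, hφ⟩ := Submodule.exists_coordinates_mod (F := F)
    (V := (M ^ i).restrictScalars F) (W := (M ^ (i + 1)).restrictScalars F)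
    (fun x hx => Ideal.pow_le_pow_right (Nat.le_succ i) hx)
  suffices k ≤ d by omega
  let Y : MvPolynomial (Fin k) A := ∑ j, X j * C (u j)
  have hY : Y ∈ M.map C :=
    Ideal.sum_mem _ fun j _ => Ideal.mul_mem_left _ _ (Ideal.mem_map_of_mem _ (hu j))
  have hYp : Y ^ p = ∑ j, MvPolynomial.map (algebraMap F A) (X j ^ p) * C (u j ^ p) := by
    simp [Y, sum_pow_char, mul_pow]
  let f : Fin d → MvPolynomial (Fin k) F := fun l => mapFunctional (φ l) (Y ^ i)
  have hYi : Y ^ i - ∑ l, MvPolynomial.map (algebraMap F A) (f l) * C (e l) ∈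
      (M ^ (i + 1)).map C := by
    rw [MvPolynomial.mem_map_C_iff]
    intro s
    have hs : coeff s (Y ^ i) ∈ M ^ i := by
      refine MvPolynomial.mem_map_C_iff.mp ?_ s
      rw [Ideal.map_pow]
      exact Ideal.pow_mem_pow hY i
    have hcoeff : coeff s (Y ^ i - ∑ l, MvPolynomial.map (algebraMap F A) (f l) * C (e l)) =
        coeff s (Y ^ i) - ∑ l, φ l (coeff s (Y ^ i)) • e l := by
      simp only [f, coeff_sub, coeff_sum, mul_comm _ (C _), coeff_C_mul, MvPolynomial.coeff_map,
        coeff_mapFunctional, Algebra.smul_def, mul_comm (e _)]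
    rw [hcoeff]
    exact hφ _ hs
  have hdiff : Y ^ p - ∑ l, MvPolynomial.map (algebraMap F A) (f l) * (C (e l) * Y ^ (p - i)) ∈
      (M ^ (p + 1)).map C := by
    have hmul := Ideal.mul_mem_mul hYi (Ideal.pow_mem_pow hY (p - i))
    rw [Ideal.map_pow, ← pow_add, sub_mul, ← pow_add, Finset.sum_mul,
      show i + 1 + (p - i) = p + 1 by omega, show i + (p - i) = p by omega] at hmul
    simpa only [Ideal.map_pow, mul_assoc] using hmul
  refine le_of_X_pow_mem_span f (fun l => ?_) p fun j => ?_
  · have hY0 : constantCoeff Y = 0 := by simp [Y]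
    have : constantCoeff (Y ^ i) = 0 := by rw [map_pow, hY0, zero_pow (by omega)]
    rw [constantCoeff_eq] at this
    simp [f, this]
  · have hzero : mapFunctional (ψ j)
        (Y ^ p - ∑ l, MvPolynomial.map (algebraMap F A) (f l) * (C (e l) * Y ^ (p - i))) = 0 := by
      ext s
      rw [coeff_mapFunctional, coeff_zero]
      exact hψ j _ (MvPolynomial.mem_map_C_iff.mp hdiff s)
    rw [map_sub, sub_eq_zero, hYp, map_sum, map_sum] at hzero
    simp only [mapFunctional_map_mul, mapFunctional_C, hψu] at hzero
    simp only [apply_ite C, map_one, map_zero, mul_ite, mul_one, mul_zero, Finset.sum_ite_eq,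
      Finset.mem_univ, if_true] at hzero
    rw [hzero]
    exact Ideal.sum_mem _ fun l _ =>
      Ideal.mul_mem_right _ _ (Ideal.subset_span (Set.mem_range_self l))

theorem Ideal.mul_le_finrank {A : Type*} [CommRing A] [Algebra F A]
    [FiniteDimensional F A] (M : Ideal A) {p : ℕ} [ExpChar A p] {k : ℕ} (u : Fin k → A)
    (hu : ∀ j, u j ∈ M) (ψ : Fin k → A →ₗ[F] F)
    (hψu : ∀ j m, ψ j (u m ^ p) = if j = m then 1 else 0)
    (hψ : ∀ j, ∀ a ∈ M ^ (p + 1), ψ j a = 0) :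
    p * k ≤ Module.finrank F (M.restrictScalars F) := by
  have h : ∀ i ≤ p, i * k + Module.finrank F ((M ^ (i + 1)).restrictScalars F) ≤
      Module.finrank F (M.restrictScalars F) := by
    intro i
    induction i with
    | zero =>
      intro _
      rw [zero_mul, zero_add, zero_add, pow_one]
    | succ i ih =>
      intro hi
      have h1 := ih (by omega)
      have h2 := M.add_finrank_pow_succ_le u hu ψ hψu hψ (i := i + 1) (by omega) hi
      rw [add_mul, one_mul]
      omega
  exact (Nat.le_add_right _ _).trans (h p le_rfl)

variable {R : Type*} [NonUnitalCommRing R] [Module F R] [SMulCommClass F R R]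
  [IsScalarTower F R R]

theorem Unitization.inr_pw_s6 (x : R) : ∀ {n : ℕ}, 1 ≤ n →
    (Unitization.inr (pw x n) : Unitization F R) = Unitization.inr x ^ n
  | 1, _ => by simp [pw]
  | n + 2, _ => by
    rw [pw, Unitization.inr_mul, Unitization.inr_pw_s6 x (Nat.le_add_left 1 n), pow_succ' _ (n + 1)]

theorem Unitization.snd_mem_pw_of_mem_ker_pow : ∀ {n : ℕ}, 1 ≤ n → ∀ a : Unitization F R,
    a ∈ RingHom.ker (Unitization.fstHom F R) ^ n → a.snd ∈ pw (⊤ : Submodule F R) n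
  | 1, _, _, _ => Submodule.mem_top
  | n + 2, _, a, ha => by
    rw [pow_succ'] at ha
    have hsub : RingHom.ker (Unitization.fstHom F R) ^ (n + 1) ≤
        RingHom.ker (Unitization.fstHom F R) := Ideal.pow_le_self (Nat.succ_ne_zero n)
    refine Submodule.mul_induction_on ha (fun x hx y hy => ?_) fun x y hx hy => ?_
    · have hx0 : x.fst = 0 := hx
      have hy0 : y.fst = 0 := hsub hy
      rw [Unitization.snd_mul, hx0, hy0, zero_smul, zero_smul, zero_add, zero_add]
      exact Submodule.subset_span ⟨_, Submodule.mem_top, _,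
        Unitization.snd_mem_pw_of_mem_ker_pow (Nat.le_add_left 1 n) y hy, rfl⟩
    · rw [Unitization.snd_add]
      exact add_mem hx hy

end

theorem stmt_6 {F R : Type*} [Field F] (p : ℕ) (hp : p.Prime) [CharP F p]
    (hperf : ∀ a : F, ∃ b : F, b ^ p = a)
    [NonUnitalCommRing R] [Module F R] [SMulCommClass F R R] [IsScalarTower F R R]
    [FiniteDimensional F R]
    (hnil : ∃ m, 1 ≤ m ∧ pw (⊤ : Submodule F R) m = ⊥) :
    p * Module.finrank F
        (↥(Submodule.span F (Set.range fun x : R => pw x p)) ⧸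
          Submodule.comap (Submodule.span F (Set.range fun x : R => pw x p)).subtype
            (pw (⊤ : Submodule F R) (p + 1)))
      ≤ Module.finrank F R := by
  set P := Submodule.span F (Set.range fun x : R => pw x p) with hP
  set N := pw (⊤ : Submodule F R) (p + 1)
  have hspan : P.map N.mkQ = Submodule.span F (Set.range fun x : R => N.mkQ (pw x p)) := by
    rw [hP, Submodule.map_span, ← Set.range_comp]
    rfl
  have hker : Submodule.comap P.subtype N = LinearMap.ker (N.mkQ.domRestrict P) := by
    rw [LinearMap.ker_domRestrict, Submodule.ker_mkQ]
  rw [hker, (N.mkQ.domRestrict P).quotKerEquivRange.finrank_eq, LinearMap.range_domRestrict, hspan]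
  obtain ⟨v, hv, -, hli⟩ := Submodule.exists_fun_fin_finrank_span_eq F
    (Set.range fun x : R => N.mkQ (pw x p))
  generalize Module.finrank F (Submodule.span F (Set.range fun x : R => N.mkQ (pw x p))) = k
    at v hv hli ⊢
  choose u hu using hv
  obtain ⟨g, hg⟩ := LinearMap.exists_leftInverse_of_injective (Fintype.linearCombination F v)
    (LinearMap.ker_eq_bot.mpr hli.fintypeLinearCombination_injective)
  let A := Unitization F R
  have : FiniteDimensional F A :=
    Module.Finite.equiv (Unitization.linearEquiv F F R).symm
  have : CharP A p := charP_of_injective_algebraMap (algebraMap F A).injective p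
  have : ExpChar A p := ExpChar.prime hp
  have hmain := Ideal.mul_le_finrank (F := F) (RingHom.ker (Unitization.fstHom F R)) (p := p)
    (fun j => (Unitization.inr (u j) : A)) (fun j => Unitization.fst_inr F (u j))
    (fun j => LinearMap.proj j ∘ₗ g ∘ₗ N.mkQ ∘ₗ Unitization.sndHom F F R) (fun j m => ?_)
    fun j a ha => ?_
  · refine hmain.trans ?_
    refine LinearMap.finrank_le_finrank_of_injective
      (f := (Unitization.sndHom F F R).domRestrict _) ?_
    rintro ⟨x, hx⟩ ⟨y, hy⟩ hxy
    exact Subtype.ext (Unitization.ext (hx.trans hy.symm) hxy)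
  · have hgm := LinearMap.congr_fun hg (Pi.single m 1)
    rw [← Unitization.inr_pw_s6 _ hp.one_le]
    have : N.mkQ (pw (u m) p) = v m := hu m
    simp only [LinearMap.comp_apply, Fintype.linearCombination_apply_single, one_smul,
      LinearMap.id_apply] at hgm
    simp only [LinearMap.comp_apply, Unitization.sndHom_apply, Unitization.snd_inr, this, hgm,
      LinearMap.proj_apply, Pi.single_apply]
  · have h0 : N.mkQ a.snd = 0 := (Submodule.Quotient.mk_eq_zero N).mpr
      (Unitization.snd_mem_pw_of_mem_ker_pow (Nat.le_add_left 1 p) a ha)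
    simp only [LinearMap.comp_apply, Unitization.sndHom_apply, h0, map_zero]
end

section
/- For any field F there exists a commutative graded F-algebra R, generated by its degree-1 component, whose homogeneous components R_1, R_2, R_3, R_4 have dimensions 4, 3, 4, 3 respectively. -/
open Pointwise

/-- A witness for Statement 9: a commutative graded $F$-algebra $R$, generated by its
degree-$1$ component, whose components $R_1,R_2,R_3,R_4$ have dimensions $4,3,4,3$. -/
structure Stmt9Witness (F : Type u) [Field F] where
  R : Type u
  [ring : NonUnitalCommRing R]
  [mod : Module F R]
  [scc : SMulCommClass F R R]
  [ist : IsScalarTower F R R]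
  grading : ℕ → Submodule F R
  mul_le : ∀ i j, grading i * grading j ≤ grading (i + j)
  internal : DirectSum.IsInternal grading
  zero_bot : grading 0 = ⊥
  gen : NonUnitalAlgebra.adjoin F ((grading 1 : Submodule F R) : Set R) = ⊤
  dim1 : Module.finrank F (grading 1) = 4
  dim2 : Module.finrank F (grading 2) = 3
  dim3 : Module.finrank F (grading 3) = 4
  dim4 : Module.finrank F (grading 4) = 3

/-- The vector space with basis the monomials
`x, y, z₁, z₂, x², xy, y², x³, x²y, xy², y³, x⁴, x³y, x²y²`, in this order. -/
def MonomialAlgebra (F : Type u) : Type u := Fin 14 → F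

namespace MonomialAlgebra

/-- The degree of the `k`-th monomial. -/
def deg : Fin 14 → ℕ := ![1, 1, 1, 1, 2, 2, 2, 3, 3, 3, 3, 4, 4, 4]

/-- The ordered factorizations of the `k`-th monomial into two monomials. -/
def factors : Fin 14 → Finset (Fin 14 × Fin 14) :=
  ![∅, ∅, ∅, ∅,
    {(0, 0)}, {(0, 1), (1, 0)}, {(1, 1)},
    {(0, 4), (4, 0)}, {(0, 5), (1, 4), (4, 1), (5, 0)},
    {(0, 6), (1, 5), (5, 1), (6, 0)}, {(1, 6), (6, 1)},
    {(0, 7), (4, 4), (7, 0)}, {(0, 8), (1, 7), (4, 5), (5, 4), (7, 1), (8, 0)},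
    {(0, 9), (1, 8), (4, 6), (5, 5), (6, 4), (8, 1), (9, 0)}]

set_option maxRecDepth 4000 in
theorem deg_add_deg : ∀ k, ∀ p ∈ factors k, deg p.1 + deg p.2 = deg k := by decide

theorem one_le_deg : ∀ k, 1 ≤ deg k := by decide

@[ext]
theorem ext {F : Type u} {f g : MonomialAlgebra F} (h : ∀ k, f k = g k) : f = g := funext h

variable {F : Type u} [Field F]

instance : AddCommGroup (MonomialAlgebra F) := inferInstanceAs (AddCommGroup (Fin 14 → F))

instance : Module F (MonomialAlgebra F) := inferInstanceAs (Module F (Fin 14 → F))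

instance : Mul (MonomialAlgebra F) := ⟨fun f g k => ∑ p ∈ factors k, f p.1 * g p.2⟩

theorem mul_apply (f g : MonomialAlgebra F) (k : Fin 14) :
    (f * g) k = ∑ p ∈ factors k, f p.1 * g p.2 := rfl

theorem add_apply (f g : MonomialAlgebra F) (k : Fin 14) : (f + g) k = f k + g k := rfl

theorem zero_apply (k : Fin 14) : (0 : MonomialAlgebra F) k = 0 := rfl

theorem smul_apply (c : F) (f : MonomialAlgebra F) (k : Fin 14) : (c • f) k = c * f k := rfl

theorem mul_comm' (f g : MonomialAlgebra F) : f * g = g * f := by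
  ext k
  fin_cases k <;> simp [mul_apply, factors] <;> ring

theorem mul_assoc' (f g h : MonomialAlgebra F) : f * g * h = f * (g * h) := by
  ext k
  fin_cases k <;> simp [mul_apply, factors] <;> ring

instance : NonUnitalCommRing (MonomialAlgebra F) where
  left_distrib f g h := by
    ext k
    simp [mul_apply, add_apply, mul_add, Finset.sum_add_distrib]
  right_distrib f g h := by
    ext k
    simp [mul_apply, add_apply, add_mul, Finset.sum_add_distrib]
  zero_mul f := by
    ext k
    simp [mul_apply, zero_apply]
  mul_zero f := by
    ext k
    simp [mul_apply, zero_apply]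
  mul_assoc := mul_assoc'
  mul_comm := mul_comm'

instance : IsScalarTower F (MonomialAlgebra F) (MonomialAlgebra F) where
  smul_assoc c f g := by
    ext k
    simp [mul_apply, smul_apply, Finset.mul_sum, mul_assoc]

instance : SMulCommClass F (MonomialAlgebra F) (MonomialAlgebra F) where
  smul_comm c f g := by
    ext k
    simp [mul_apply, smul_apply, Finset.mul_sum, mul_left_comm]

variable (F) in
/-- The span of the monomials of degree `n`. -/
def component (n : ℕ) : Submodule F (MonomialAlgebra F) :=
  ⨅ k ∈ {k | deg k ≠ n}, LinearMap.ker (LinearMap.proj (R := F) (φ := fun _ => F) k)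

theorem mem_component {n : ℕ} {f : MonomialAlgebra F} :
    f ∈ component F n ↔ ∀ k, deg k ≠ n → f k = 0 := by
  unfold component
  erw [Submodule.mem_iInf]
  refine forall_congr' fun k => ?_
  erw [Submodule.mem_iInf]
  rfl

theorem finrank_component (n : ℕ) :
    Module.finrank F (component F n) = (Finset.univ.filter fun k => deg k = n).card := by
  have e := LinearMap.iInfKerProjEquiv F (fun _ : Fin 14 => F)
    (I := {k | deg k = n}) (J := {k | deg k ≠ n})
    (Set.disjoint_left.2 fun _ h h' => h' h) (fun k _ => em (deg k = n))
  refine (LinearEquiv.finrank_eq e).trans ?_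
  rw [Module.finrank_fintype_fun_eq_card, ← Set.toFinset_card]
  congr 1
  ext k
  simp

/-- The `k`-th monomial. -/
def monomial (k : Fin 14) : MonomialAlgebra F := Pi.single k 1

theorem monomial_apply (k l : Fin 14) :
    (monomial k : MonomialAlgebra F) l = if l = k then 1 else 0 := Pi.single_apply ..

theorem monomial_mem_component (k : Fin 14) :
    (monomial k : MonomialAlgebra F) ∈ component F (deg k) := by
  rw [mem_component]
  intro l hl
  rw [monomial_apply, if_neg]
  rintro rfl
  exact hl rfl

theorem eq_top_of_monomial_mem {V : Submodule F (MonomialAlgebra F)}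
    (h : ∀ k, monomial k ∈ V) : V = ⊤ := by
  refine eq_top_iff.2 fun f _ => ?_
  have hf : f = ∑ k, f k • (monomial k : MonomialAlgebra F) := pi_eq_sum_univ' f
  rw [hf]
  exact V.sum_mem fun k _ => V.smul_mem _ (h k)

theorem component_mul_le (i j : ℕ) :
    component F i * component F j ≤ component F (i + j) := by
  refine Submodule.span_le.2 ?_
  rintro _ ⟨f, hf, g, hg, rfl⟩
  refine mem_component.2 fun k hk => Finset.sum_eq_zero fun p hp => ?_
  have hdeg := deg_add_deg k p hp
  by_cases hi : deg p.1 = i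
  · rw [mem_component.1 hg p.2 (by omega), mul_zero]
  · rw [mem_component.1 hf p.1 hi, zero_mul]

theorem isInternal_component : DirectSum.IsInternal (component F) := by
  refine DirectSum.isInternal_submodule_of_iSupIndep_of_iSup_eq_top ?_ ?_
  · intro n
    rw [Submodule.disjoint_def]
    intro f hf hf'
    ext k
    by_cases hk : deg k = n
    · have hle : ⨆ j, ⨆ (_ : j ≠ n), component F j ≤
          LinearMap.ker (LinearMap.proj (R := F) (φ := fun _ => F) k) :=
        iSup₂_le fun j hj g hg => mem_component.1 hg k (hk.trans_ne hj.symm)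
      exact hle hf'
    · exact mem_component.1 hf k hk
  · exact eq_top_of_monomial_mem fun k =>
      Submodule.mem_iSup_of_mem (deg k) (monomial_mem_component k)

theorem component_zero : component F 0 = ⊥ := by
  refine eq_bot_iff.2 fun f hf => ?_
  rw [Submodule.mem_bot]
  ext k
  exact mem_component.1 hf k (Nat.one_le_iff_ne_zero.1 (one_le_deg k))

theorem exists_unique_factorization : ∀ k, deg k ≠ 1 →
    ∃ i < k, ∃ j < k, ∀ l, (i, j) ∈ factors l ↔ l = k := by
  decide

theorem monomial_mul_monomial {i j k : Fin 14} (h : ∀ l, (i, j) ∈ factors l ↔ l = k) :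
    (monomial i * monomial j : MonomialAlgebra F) = monomial k := by
  ext l
  have hterm (p : Fin 14 × Fin 14) :
      (monomial i : MonomialAlgebra F) p.1 * (monomial j : MonomialAlgebra F) p.2 =
        if p = (i, j) then 1 else 0 := by
    simp only [monomial_apply, ite_zero_mul_ite_zero, one_mul, Prod.ext_iff]
  simp_rw [mul_apply, hterm, Finset.sum_ite_eq', h, monomial_apply]

theorem adjoin_component_one :
    NonUnitalAlgebra.adjoin F (component F 1 : Set (MonomialAlgebra F)) = ⊤ := by
  have hmem (k : Fin 14) :
      monomial k ∈ NonUnitalAlgebra.adjoin F (component F 1 : Set (MonomialAlgebra F)) := by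
    induction k using WellFoundedLT.induction with
    | ind k ih =>
      by_cases hk : deg k = 1
      · exact NonUnitalAlgebra.subset_adjoin F (hk ▸ monomial_mem_component k)
      · obtain ⟨i, hi, j, hj, h⟩ := exists_unique_factorization k hk
        rw [← monomial_mul_monomial h]
        exact mul_mem (ih i hi) (ih j hj)
  have htop := eq_top_of_monomial_mem
    (V := (NonUnitalAlgebra.adjoin F (component F 1 : Set (MonomialAlgebra F))).toSubmodule) hmem
  exact NonUnitalAlgebra.toSubmodule_eq_top.1 htop

end MonomialAlgebra

open MonomialAlgebra in
theorem stmt_9 (F : Type u) [Field F] : Nonempty (Stmt9Witness F) :=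
  ⟨{  R := MonomialAlgebra F
      grading := component F
      mul_le := component_mul_le
      internal := isInternal_component
      zero_bot := component_zero
      gen := adjoin_component_one
      dim1 := (finrank_component 1).trans (by decide)
      dim2 := (finrank_component 2).trans (by decide)
      dim3 := (finrank_component 3).trans (by decide)
      dim4 := (finrank_component 4).trans (by decide) }⟩
end
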